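/- Let μ_n = E(X_n) under the uniform measure, and let (θ_n) and (ρ_n) be sequences of positive reals with ρ_n > 1, θ_n → ∞, μ_n/θ_n → λ for some λ ∈ [0,∞), and θ_n/ρ_n → α for some α ∈ [0,∞). Then for every t ∈ ℝ: lim_{n→∞} (θ_n/μ_n)·log E^{v,1/ρ_n}_{k,n}(e^{t·X_n/θ_n}) = t. In particular, if (ρ_n) is a sequence of positive reals with ρ_n > 1 and lim_{n→∞} n^ℓ/ρ_n ∈ [0,∞), then for every t ∈ ℝ: lim_{n→∞} E^{v,1/ρ_n}_{k,n}(e^{t·X_n/n^ℓ}) = exp[ t·C(k,d)/(k^ℓ·ℓ!) ]. -/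

import Mathlib

open Filter Topology

/-- The number of occurrences of the pattern `v : Fin ℓ → Fin k` in the word
`w : Fin n → Fin k`: the number of strictly increasing index tuples along which
`w` is order-isomorphic (including equalities) to `v`. -/
noncomputable def occ (k ℓ n : ℕ) (v : Fin ℓ → Fin k) (w : Fin n → Fin k) : ℕ :=
  Nat.card {j : Fin ℓ → Fin n // StrictMono j ∧
    ∀ p q : Fin ℓ, (w (j p) < w (j q) ↔ v p < v q) ∧ (w (j p) = w (j q) ↔ v p = v q)}

/-- `fword k ℓ v r n` = number of words in `[k]^n` containing `v` exactly `r` times. -/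
noncomputable def fword (k ℓ : ℕ) (v : Fin ℓ → Fin k) (r n : ℕ) : ℕ :=
  Nat.card {w : Fin n → Fin k // occ k ℓ n v w = r}

/-- `gword k ℓ v r n` = number of words in `[k]^n` containing `v` at most `r` times. -/
noncomputable def gword (k ℓ : ℕ) (v : Fin ℓ → Fin k) (r n : ℕ) : ℕ :=
  ∑ j ∈ Finset.range (r + 1), fword k ℓ v j n

/-- The number of distinct letters appearing in the pattern `v`. -/
noncomputable def dLetters (k ℓ : ℕ) (v : Fin ℓ → Fin k) : ℕ :=
  (Finset.univ.image v).card

/-- `μ_n = E(X_n)`, the mean number of occurrences of `v` in a uniformly random word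
`W_n ∈ [k]^n`. -/
noncomputable def muX (k ℓ : ℕ) (v : Fin ℓ → Fin k) (n : ℕ) : ℝ :=
  (∑ w : Fin n → Fin k, (occ k ℓ n v w : ℝ)) / (k : ℝ) ^ n

/-- `Var(X_n)`, the variance of the number of occurrences of `v` in a uniformly random
word `W_n ∈ [k]^n`. -/
noncomputable def varX (k ℓ : ℕ) (v : Fin ℓ → Fin k) (n : ℕ) : ℝ :=
  (∑ w : Fin n → Fin k, ((occ k ℓ n v w : ℝ) - muX k ℓ v n) ^ 2) / (k : ℝ) ^ n

/-- The weak-avoidance partition function `c_{k,n}^v(x) = Σ_{w ∈ [k]^n} (1-x)^{occ_v(w)}`. -/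
noncomputable def cfun (k ℓ : ℕ) (v : Fin ℓ → Fin k) (n : ℕ) (x : ℝ) : ℝ :=
  ∑ w : Fin n → Fin k, (1 - x) ^ (occ k ℓ n v w)

/-- Expectation with respect to the Boltzmann measure `Q^{v,x}_{k,n}` on `[k]^n`, which
assigns to a word `w` the probability `(1-x)^{occ_v(w)}/c_{k,n}^v(x)`. -/
noncomputable def Ewt (k ℓ : ℕ) (v : Fin ℓ → Fin k) (n : ℕ) (x : ℝ)
    (f : (Fin n → Fin k) → ℝ) : ℝ :=
  (∑ w : Fin n → Fin k, (1 - x) ^ (occ k ℓ n v w) * f w) / cfun k ℓ v n x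

section Occurrences

open scoped BigOperators
open Finset

theorem Fintype.expect_comp_injective {ι β A : Type*} [Fintype ι] [Fintype β] [Fintype A]
    [DecidableEq ι] [DecidableEq β] [Nonempty A]
    {e : ι → β} (he : Function.Injective e) (F : (ι → A) → ℝ) :
    𝔼 w : β → A, F (w ∘ e) = 𝔼 u : ι → A, F u := by
  classical
  let E : (β → A) ≃ (ι → A) × ({b // ¬ b ∈ Set.range e} → A) :=
    (Equiv.piEquivPiSubtypeProd (· ∈ Set.range e) fun _ => A).trans
      (Equiv.prodCongr ((Equiv.ofInjective e he).symm.arrowCongr (Equiv.refl A)) (Equiv.refl _))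
  have hE : ∀ w, (E w).1 = w ∘ e := fun w => by
    funext i
    simp [E, Equiv.arrowCongr]
  calc 𝔼 w : β → A, F (w ∘ e) = 𝔼 x : (ι → A) × ({b // ¬ b ∈ Set.range e} → A), F x.1 :=
        Fintype.expect_equiv E _ _ fun w => by rw [hE]
    _ = 𝔼 u : ι → A, F u := by
        rw [← Finset.univ_product_univ, Finset.expect_product]
        simp

/-- Two words of the same length are order-isomorphic, equalities included. -/
def SameOrder {k ℓ : ℕ} (u v : Fin ℓ → Fin k) : Prop :=
  ∀ p q : Fin ℓ, (u p < u q ↔ v p < v q) ∧ (u p = u q ↔ v p = v q)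

/-- The increasing index tuples of length `ℓ` in `Fin n`. -/
noncomputable def incTuples (ℓ n : ℕ) : Finset (Fin ℓ → Fin n) :=
  open Classical in univ.filter StrictMono

theorem card_strictMono_fin (d k : ℕ) : Nat.card {f : Fin d → Fin k // StrictMono f} = k.choose d := by
  have e : {f : Fin d → Fin k // StrictMono f} ≃ (Fin d ↪o Fin k) :=
    { toFun := fun f => OrderEmbedding.ofStrictMono f.1 f.2
      invFun := fun f => ⟨f, f.strictMono⟩
      left_inv := fun f => rfl
      right_inv := fun f => rfl }
  rw [Nat.card_congr (e.trans Set.powersetCard.ofFinEmbEquiv), Set.powersetCard.card]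
  simp

theorem card_incTuples (ℓ n : ℕ) : #(incTuples ℓ n) = n.choose ℓ := by
  classical
  rw [← card_strictMono_fin, Nat.card_eq_fintype_card, Fintype.card_subtype]
  rfl

theorem card_sameOrder (k ℓ : ℕ) (v : Fin ℓ → Fin k) :
    Nat.card {u : Fin ℓ → Fin k // SameOrder u v} = k.choose (dLetters k ℓ v) := by
  classical
  rw [← card_strictMono_fin]
  let e := (univ.image v).orderIsoOfFin (k := dLetters k ℓ v) rfl
  let r : Fin ℓ → Fin (dLetters k ℓ v) := fun p => e.symm ⟨v p, by simp⟩
  have hr : Function.Surjective r := fun i => by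
    obtain ⟨p, -, hp⟩ := mem_image.1 (e i).2
    exact ⟨p, by simp [r, hp]⟩
  have hlt : ∀ p q, r p < r q ↔ v p < v q := fun p q => by simp [r]
  have heq : ∀ p q, r p = r q ↔ v p = v q := fun p q => by simp [r]
  symm
  refine Nat.card_eq_of_bijective
    (fun f => ⟨f.1 ∘ r, fun p q => ⟨?_, ?_⟩⟩) ⟨?_, ?_⟩
  · simpa [hlt] using f.2.lt_iff_lt (a := r p) (b := r q)
  · simpa [heq] using f.2.injective.eq_iff (a := r p) (b := r q)
  · intro f g h
    have h' : f.1 ∘ r = g.1 ∘ r := congrArg Subtype.val h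
    exact Subtype.ext (hr.injective_comp_right h')
  · rintro ⟨u, hu⟩
    choose s hs using hr
    refine ⟨⟨u ∘ s, fun i j hij => ?_⟩, Subtype.ext (funext fun p => ?_)⟩
    · exact (hu _ _).1.2 ((hlt _ _).1 (by simpa [hs] using hij))
    · exact (hu _ _).2.2 ((heq _ _).1 (hs _))

open Classical in
/-- The indicator that a word is order-isomorphic to the pattern. -/
noncomputable def matchInd {k ℓ : ℕ} (v u : Fin ℓ → Fin k) : ℝ := if SameOrder u v then 1 else 0

theorem matchInd_nonneg {k ℓ : ℕ} (v u : Fin ℓ → Fin k) : 0 ≤ matchInd v u := by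
  unfold matchInd; split_ifs <;> norm_num

theorem matchInd_le_one {k ℓ : ℕ} (v u : Fin ℓ → Fin k) : matchInd v u ≤ 1 := by
  unfold matchInd; split_ifs <;> norm_num

theorem occ_eq_sum (k ℓ n : ℕ) (v : Fin ℓ → Fin k) (w : Fin n → Fin k) :
    (occ k ℓ n v w : ℝ) = ∑ j ∈ incTuples ℓ n, matchInd v (w ∘ j) := by
  classical
  unfold occ matchInd incTuples
  rw [Nat.card_eq_fintype_card, Fintype.card_subtype, ← Finset.filter_filter, Finset.sum_boole]
  congr!

theorem occ_le_choose (k ℓ n : ℕ) (v : Fin ℓ → Fin k) (w : Fin n → Fin k) :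
    (occ k ℓ n v w : ℝ) ≤ n.choose ℓ := by
  rw [occ_eq_sum, ← card_incTuples]
  simpa using Finset.sum_le_card_nsmul (incTuples ℓ n) _ 1 fun j _ => matchInd_le_one v (w ∘ j)

/-- The probability that a uniform word of length `ℓ` is order-isomorphic to the pattern. -/
noncomputable def matchProb (k ℓ : ℕ) (v : Fin ℓ → Fin k) : ℝ :=
  k.choose (dLetters k ℓ v) / (k : ℝ) ^ ℓ

theorem matchProb_pos {k ℓ : ℕ} (hk : 1 ≤ k) (v : Fin ℓ → Fin k) : 0 < matchProb k ℓ v := by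
  have h : dLetters k ℓ v ≤ k := (card_le_univ _).trans_eq (Fintype.card_fin k)
  have := Nat.choose_pos h
  unfold matchProb
  positivity

theorem expect_matchInd (k ℓ : ℕ) (v : Fin ℓ → Fin k) :
    𝔼 u, matchInd v u = matchProb k ℓ v := by
  classical
  rw [Fintype.expect_eq_sum_div_card, matchProb, ← card_sameOrder, Nat.card_eq_fintype_card,
    Fintype.card_subtype]
  simp [matchInd]

theorem expect_matchInd_comp {k ℓ n : ℕ} (hk : 1 ≤ k) (v : Fin ℓ → Fin k) {j : Fin ℓ → Fin n}
    (hj : Function.Injective j) :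
    𝔼 w : Fin n → Fin k, matchInd v (w ∘ j) = matchProb k ℓ v := by
  have : Nonempty (Fin k) := ⟨⟨0, hk⟩⟩
  rw [Fintype.expect_comp_injective hj, expect_matchInd]

theorem muX_eq_expect (k ℓ : ℕ) (v : Fin ℓ → Fin k) (n : ℕ) :
    muX k ℓ v n = 𝔼 w : Fin n → Fin k, (occ k ℓ n v w : ℝ) := by
  simp [muX, Fintype.expect_eq_sum_div_card]

theorem varX_eq_expect (k ℓ : ℕ) (v : Fin ℓ → Fin k) (n : ℕ) :
    varX k ℓ v n = 𝔼 w : Fin n → Fin k, ((occ k ℓ n v w : ℝ) - muX k ℓ v n) ^ 2 := by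
  simp [varX, Fintype.expect_eq_sum_div_card]

theorem injective_of_mem_incTuples {ℓ n : ℕ} {j : Fin ℓ → Fin n} (hj : j ∈ incTuples ℓ n) :
    Function.Injective j := by
  classical
  simp only [incTuples, mem_filter, mem_univ, true_and] at hj
  exact hj.injective

theorem muX_eq {k : ℕ} (ℓ : ℕ) (hk : 1 ≤ k) (v : Fin ℓ → Fin k) (n : ℕ) :
    muX k ℓ v n = n.choose ℓ * matchProb k ℓ v := by
  simp_rw [muX_eq_expect, occ_eq_sum]
  rw [Finset.expect_sum_comm, Finset.sum_congr rfl fun j hj =>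
    expect_matchInd_comp hk v (injective_of_mem_incTuples hj)]
  simp [card_incTuples]

theorem expect_matchInd_mul {k ℓ n : ℕ} (hk : 1 ≤ k) (v : Fin ℓ → Fin k) {i j : Fin ℓ → Fin n}
    (hi : Function.Injective i) (hj : Function.Injective j) (hij : ∀ p q, i p ≠ j q) :
    𝔼 w : Fin n → Fin k, matchInd v (w ∘ i) * matchInd v (w ∘ j) = matchProb k ℓ v ^ 2 := by
  have : Nonempty (Fin k) := ⟨⟨0, hk⟩⟩
  have h := Fintype.expect_comp_injective (A := Fin k) (hi.sumElim hj hij)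
    (fun u => matchInd v (u ∘ Sum.inl) * matchInd v (u ∘ Sum.inr))
  simp only [Function.comp_assoc, Sum.elim_comp_inl, Sum.elim_comp_inr] at h
  rw [h, Fintype.expect_equiv (Equiv.sumArrowEquivProdArrow _ _ _)
    (fun u => matchInd v (u ∘ Sum.inl) * matchInd v (u ∘ Sum.inr)) (fun x => matchInd v x.1 * matchInd v x.2) (fun _ => rfl), ← Finset.univ_product_univ,
    Finset.expect_product]
  simp_rw [← Finset.mul_expect, ← Finset.expect_mul, expect_matchInd]
  ring

theorem card_filter_apply_eq_le {ℓ n : ℕ} (p q : Fin ℓ) :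
    #{x : (Fin ℓ → Fin n) × (Fin ℓ → Fin n) | x.1 p = x.2 q} ≤ n ^ (2 * ℓ - 1) := by
  classical
  calc _ ≤ #(univ : Finset ((Fin ℓ → Fin n) × ({i : Fin ℓ // i ≠ q} → Fin n))) := by
        refine card_le_card_of_injOn (fun x => (x.1, fun i => x.2 i)) (fun _ _ => by simp) ?_
        rintro ⟨a, b⟩ hx ⟨a', b'⟩ hy h
        simp only [coe_filter, mem_univ, true_and, Set.mem_ofPred_eq] at hx hy
        simp only [Prod.mk.injEq] at h ⊢
        obtain ⟨rfl, h⟩ := h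
        refine ⟨rfl, funext fun i => ?_⟩
        by_cases hi : i = q
        · rw [hi, ← hx, ← hy]
        · exact congrFun h ⟨i, hi⟩
    _ = n ^ ℓ * n ^ (ℓ - 1) := by simp [Fintype.card_subtype_compl]
    _ = n ^ (2 * ℓ - 1) := by
        rw [← pow_add]
        congr 1
        have := p.pos
        omega

theorem varX_le {k : ℕ} (ℓ : ℕ) (hk : 1 ≤ k) (v : Fin ℓ → Fin k) (n : ℕ) :
    varX k ℓ v n ≤ ℓ ^ 2 * n ^ (2 * ℓ - 1) := by
  classical
  have : Nonempty (Fin k) := ⟨⟨0, hk⟩⟩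
  set S := incTuples ℓ n
  have hvar : varX k ℓ v n
      = 𝔼 w : Fin n → Fin k, (occ k ℓ n v w : ℝ) ^ 2 - muX k ℓ v n ^ 2 := by
    have h : ∀ w : Fin n → Fin k, ((occ k ℓ n v w : ℝ) - muX k ℓ v n) ^ 2
        = (occ k ℓ n v w : ℝ) ^ 2 - 2 * muX k ℓ v n * occ k ℓ n v w + muX k ℓ v n ^ 2 :=
      fun w => by ring
    rw [varX_eq_expect]
    simp_rw [h]
    rw [Finset.expect_add_distrib, Finset.expect_sub_distrib, ← Finset.mul_expect,
      ← muX_eq_expect, Fintype.expect_const]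
    ring
  have hsq : 𝔼 w : Fin n → Fin k, (occ k ℓ n v w : ℝ) ^ 2
      = ∑ x ∈ S ×ˢ S, 𝔼 w : Fin n → Fin k, matchInd v (w ∘ x.1) * matchInd v (w ∘ x.2) := by
    simp_rw [occ_eq_sum, sq, Finset.sum_mul_sum, ← Finset.sum_product']
    rw [Finset.expect_sum_comm]
  have hterm : ∀ x ∈ S ×ˢ S,
      𝔼 w : Fin n → Fin k, matchInd v (w ∘ x.1) * matchInd v (w ∘ x.2)
        ≤ matchProb k ℓ v ^ 2 + ∑ p, ∑ q, if x.1 p = x.2 q then (1 : ℝ) else 0 := by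
    intro x hx
    obtain ⟨h1, h2⟩ := mem_product.1 hx
    have hnn : ∀ p q, (0 : ℝ) ≤ if x.1 p = x.2 q then (1 : ℝ) else 0 := fun p q => by
      split_ifs <;> norm_num
    by_cases hd : ∀ p q, x.1 p ≠ x.2 q
    · rw [expect_matchInd_mul hk v (injective_of_mem_incTuples h1)
        (injective_of_mem_incTuples h2) hd]
      exact le_add_of_nonneg_right (sum_nonneg fun p _ => sum_nonneg fun q _ => hnn p q)
    · push Not at hd
      obtain ⟨p, q, hpq⟩ := hd
      have hone : 𝔼 w : Fin n → Fin k, matchInd v (w ∘ x.1) * matchInd v (w ∘ x.2) ≤ 1 :=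
        Finset.expect_le univ_nonempty fun w _ =>
          mul_le_one₀ (matchInd_le_one _ _) (matchInd_nonneg _ _) (matchInd_le_one _ _)
      have hge : (1 : ℝ) ≤ ∑ p, ∑ q, if x.1 p = x.2 q then (1 : ℝ) else 0 := by
        calc (1 : ℝ) = if x.1 p = x.2 q then (1 : ℝ) else 0 := by simp [hpq]
          _ ≤ ∑ q, if x.1 p = x.2 q then (1 : ℝ) else 0 :=
            single_le_sum (f := fun q => if x.1 p = x.2 q then (1 : ℝ) else 0)
              (fun q _ => hnn p q) (mem_univ q)
          _ ≤ _ := single_le_sum (f := fun p => ∑ q, if x.1 p = x.2 q then (1 : ℝ) else 0)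
              (fun p _ => sum_nonneg fun q _ => hnn p q) (mem_univ p)
      have := sq_nonneg (matchProb k ℓ v)
      linarith
  have hcount : ∀ p q : Fin ℓ, ∑ x ∈ S ×ˢ S, (if x.1 p = x.2 q then (1 : ℝ) else 0)
      ≤ n ^ (2 * ℓ - 1) := by
    intro p q
    rw [Finset.sum_boole]
    calc ((#{x ∈ S ×ˢ S | x.1 p = x.2 q} : ℕ) : ℝ)
        ≤ (#{x : (Fin ℓ → Fin n) × (Fin ℓ → Fin n) | x.1 p = x.2 q} : ℕ) := by
          exact_mod_cast card_le_card (filter_subset_filter _ (subset_univ _))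
      _ ≤ _ := by exact_mod_cast card_filter_apply_eq_le p q
  have hcross : ∑ x ∈ S ×ˢ S, ∑ p, ∑ q, (if x.1 p = x.2 q then (1 : ℝ) else 0)
      ≤ ℓ ^ 2 * n ^ (2 * ℓ - 1) := by
    rw [Finset.sum_comm]
    calc ∑ p, ∑ x ∈ S ×ˢ S, ∑ q, (if x.1 p = x.2 q then (1 : ℝ) else 0)
        = ∑ p, ∑ q, ∑ x ∈ S ×ˢ S, (if x.1 p = x.2 q then (1 : ℝ) else 0) :=
          sum_congr rfl fun p _ => Finset.sum_comm
      _ ≤ ∑ _p : Fin ℓ, ∑ _q : Fin ℓ, (n : ℝ) ^ (2 * ℓ - 1) :=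
          sum_le_sum fun p _ => sum_le_sum fun q _ => hcount p q
      _ = _ := by simp; ring
  have hmain := sum_le_sum hterm
  rw [sum_add_distrib, sum_const, card_product, card_incTuples, nsmul_eq_mul] at hmain
  rw [hvar, hsq, muX_eq ℓ hk]
  push_cast at hmain
  nlinarith

theorem Real.exp_le_one_add_add_sq_mul_exp_abs (x : ℝ) :
    Real.exp x ≤ 1 + x + x ^ 2 * Real.exp |x| := by
  have h := Complex.norm_exp_sub_sum_le_norm_mul_exp (x : ℂ) 2
  have h' : Complex.exp x - ∑ m ∈ Finset.range 2, (x : ℂ) ^ m / (m.factorial : ℂ)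
      = ((Real.exp x - (1 + x) : ℝ) : ℂ) := by
    simp [Finset.sum_range_succ]
  rw [h', Complex.norm_real, Complex.norm_real, Real.norm_eq_abs, Real.norm_eq_abs, sq_abs] at h
  linarith [le_abs_self (Real.exp x - (1 + x))]

theorem log_expect_exp_bounds {Ω : Type*} [Fintype Ω] [Nonempty Ω] (X : Ω → ℝ) (m K a : ℝ)
    (hm : 𝔼 w, X w = m) (hK : ∀ w, |X w - m| ≤ K) :
    0 ≤ Real.log (𝔼 w, Real.exp (a * X w)) - a * m ∧
    Real.log (𝔼 w, Real.exp (a * X w)) - a * m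
      ≤ a ^ 2 * Real.exp (|a| * K) * 𝔼 w, (X w - m) ^ 2 := by
  set M := 𝔼 w, Real.exp (a * (X w - m))
  have hM : 𝔼 w, Real.exp (a * X w) = Real.exp (a * m) * M := by
    rw [Finset.mul_expect]
    refine Finset.expect_congr rfl fun w _ => ?_
    rw [← Real.exp_add]
    ring_nf
  have hlin : 𝔼 w, (1 + a * (X w - m)) = 1 := by
    rw [Finset.expect_add_distrib, ← Finset.mul_expect, Finset.expect_sub_distrib, hm,
      Fintype.expect_const, Fintype.expect_const]
    ring
  have hlow : 1 ≤ M := by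
    rw [← hlin]
    refine Finset.expect_le_expect fun w _ => ?_
    linarith [Real.add_one_le_exp (a * (X w - m))]
  have hup : M ≤ 1 + a ^ 2 * Real.exp (|a| * K) * 𝔼 w, (X w - m) ^ 2 := by
    conv_rhs => rw [← hlin, Finset.mul_expect, ← Finset.expect_add_distrib]
    refine Finset.expect_le_expect fun w _ => ?_
    have h1 := Real.exp_le_one_add_add_sq_mul_exp_abs (a * (X w - m))
    have h2 : Real.exp |a * (X w - m)| ≤ Real.exp (|a| * K) := by
      rw [abs_mul]
      gcongr
      exact hK w
    have h3 := mul_le_mul_of_nonneg_left h2 (sq_nonneg (a * (X w - m)))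
    calc _ ≤ _ := h1.trans (add_le_add_right h3 _)
      _ = _ := by ring
  have hlog : Real.log (𝔼 w, Real.exp (a * X w)) - a * m = Real.log M := by
    rw [hM, Real.log_mul (Real.exp_pos _).ne' (by linarith), Real.log_exp]
    ring
  rw [hlog]
  exact ⟨Real.log_nonneg hlow, by linarith [Real.log_le_sub_one_of_pos (by linarith : 0 < M)]⟩

theorem log_expect_exp_occ_bounds {k : ℕ} (ℓ : ℕ) (hk : 1 ≤ k) (v : Fin ℓ → Fin k) (n : ℕ)
    (a : ℝ) :
    0 ≤ Real.log (𝔼 w : Fin n → Fin k, Real.exp (a * occ k ℓ n v w)) - a * muX k ℓ v n ∧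
    Real.log (𝔼 w : Fin n → Fin k, Real.exp (a * occ k ℓ n v w)) - a * muX k ℓ v n
      ≤ a ^ 2 * Real.exp (|a| * n.choose ℓ) * varX k ℓ v n := by
  have : Nonempty (Fin k) := ⟨⟨0, hk⟩⟩
  rw [varX_eq_expect]
  refine log_expect_exp_bounds _ _ _ a (muX_eq_expect k ℓ v n).symm fun w => ?_
  have h0 : 0 ≤ muX k ℓ v n := by unfold muX; positivity
  have h1 : muX k ℓ v n ≤ n.choose ℓ := by
    rw [muX_eq_expect]
    exact Finset.expect_le univ_nonempty fun w _ => occ_le_choose k ℓ n v w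
  have h2 := occ_le_choose k ℓ n v w
  have h3 : (0 : ℝ) ≤ occ k ℓ n v w := Nat.cast_nonneg _
  rw [abs_le]
  constructor <;> linarith

theorem muX_pos {k ℓ n : ℕ} (hk : 1 ≤ k) (v : Fin ℓ → Fin k) (hn : ℓ ≤ n) : 0 < muX k ℓ v n := by
  rw [muX_eq ℓ hk]
  exact mul_pos (by exact_mod_cast Nat.choose_pos hn) (matchProb_pos hk v)

theorem tendsto_muX_div_pow {k : ℕ} (ℓ : ℕ) (hk : 1 ≤ k) (v : Fin ℓ → Fin k) :
    Tendsto (fun n : ℕ => muX k ℓ v n / (n : ℝ) ^ ℓ) atTop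
      (𝓝 (matchProb k ℓ v / (ℓ.factorial : ℝ))) := by
  have hne : ∀ᶠ n : ℕ in atTop, (n : ℝ) ^ ℓ / (ℓ.factorial : ℝ) ≠ 0 := by
    filter_upwards [eventually_gt_atTop 0] with n hn
    positivity
  have h := (Asymptotics.isEquivalent_iff_tendsto_one hne).1 (isEquivalent_choose ℓ)
  have h' := h.mul_const (matchProb k ℓ v / (ℓ.factorial : ℝ))
  rw [one_mul] at h'
  refine h'.congr' ?_
  filter_upwards [eventually_gt_atTop 0] with n hn
  have : (ℓ.factorial : ℝ) ≠ 0 := by positivity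
  simp only [Pi.div_apply, muX_eq ℓ hk]
  field_simp

theorem tendsto_varX_div_muX_sq {k ℓ : ℕ} (hk : 1 ≤ k) (hl : 1 ≤ ℓ) (v : Fin ℓ → Fin k) :
    Tendsto (fun n : ℕ => varX k ℓ v n / muX k ℓ v n ^ 2) atTop (𝓝 0) := by
  have hp := matchProb_pos hk v
  have hne : matchProb k ℓ v / (ℓ.factorial : ℝ) ≠ 0 := by positivity
  have hlim : Tendsto (fun n : ℕ => (ℓ : ℝ) ^ 2 * ((n : ℝ)⁻¹ *
      ((muX k ℓ v n / (n : ℝ) ^ ℓ)⁻¹) ^ 2)) atTop (𝓝 0) := by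
    simpa using ((tendsto_inv_atTop_nhds_zero_nat (𝕜 := ℝ)).mul
      (((tendsto_muX_div_pow ℓ hk v).inv₀ hne).pow 2)).const_mul ((ℓ : ℝ) ^ 2)
  refine squeeze_zero' (.of_forall fun n => ?_) ?_ hlim
  · unfold varX
    positivity
  · filter_upwards [eventually_ge_atTop ℓ] with n hn
    have hmu := muX_pos hk v hn
    have hn0 : (n : ℝ) ≠ 0 := by
      have : n ≠ 0 := by omega
      exact_mod_cast this
    calc varX k ℓ v n / muX k ℓ v n ^ 2
        ≤ ℓ ^ 2 * n ^ (2 * ℓ - 1) / muX k ℓ v n ^ 2 := by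
          gcongr
          exact varX_le ℓ hk v n
      _ = _ := by
          have : (n : ℝ) ^ ℓ * n ^ ℓ = n ^ (2 * ℓ - 1) * n := by
            rw [← pow_add, ← pow_succ]
            congr 1
            omega
          field_simp
          linarith

theorem tendsto_div_muX_mul_log_expect {k ℓ : ℕ} (hk : 1 ≤ k) (hl : 1 ≤ ℓ) (v : Fin ℓ → Fin k)
    {θ a : ℕ → ℝ} {lam a₀ : ℝ} (hθ : ∀ n, 0 < θ n)
    (hlam : Tendsto (fun n => muX k ℓ v n / θ n) atTop (𝓝 lam)) (ha : Tendsto a atTop (𝓝 a₀)) :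
    Tendsto (fun n => θ n / muX k ℓ v n *
      Real.log (𝔼 w : Fin n → Fin k, Real.exp (a n / θ n * occ k ℓ n v w))) atTop (𝓝 a₀) := by
  have hp := matchProb_pos hk v
  have hbound : Tendsto (fun n => a n ^ 2 *
      Real.exp (|a n| * (muX k ℓ v n / θ n / matchProb k ℓ v)) *
      ((varX k ℓ v n / muX k ℓ v n ^ 2) * (muX k ℓ v n / θ n))) atTop (𝓝 0) := by
    simpa using ((ha.pow 2).mul
      ((ha.abs.mul (hlam.div_const _)).rexp)).mul ((tendsto_varX_div_muX_sq hk hl v).mul hlam)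
  have hrem : Tendsto (fun n => θ n / muX k ℓ v n *
      (Real.log (𝔼 w : Fin n → Fin k, Real.exp (a n / θ n * occ k ℓ n v w))
        - a n / θ n * muX k ℓ v n)) atTop (𝓝 0) := by
    refine squeeze_zero' ?_ ?_ hbound
    · filter_upwards [eventually_ge_atTop ℓ] with n hn
      have hmu := muX_pos hk v hn
      have := hθ n
      exact mul_nonneg (by positivity) (log_expect_exp_occ_bounds ℓ hk v n _).1
    · filter_upwards [eventually_ge_atTop ℓ] with n hn
      have hmu := muX_pos hk v hn
      have hθn := hθ n
      refine (mul_le_mul_of_nonneg_left (log_expect_exp_occ_bounds ℓ hk v n _).2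
        (by positivity)).trans_eq ?_
      have hexp : |a n / θ n| * (n.choose ℓ : ℝ)
          = |a n| * (muX k ℓ v n / θ n / matchProb k ℓ v) := by
        rw [abs_div, abs_of_pos hθn, muX_eq ℓ hk]
        field_simp
      rw [hexp]
      field_simp
  have h := ha.add hrem
  rw [add_zero] at h
  refine h.congr' ?_
  filter_upwards [eventually_ge_atTop ℓ] with n hn
  have hmu := muX_pos hk v hn
  have hθn := hθ n
  field_simp
  ring

theorem tendsto_mul_log_one_sub_one_div {θ ρ : ℕ → ℝ} {α : ℝ} (hθ : ∀ n, 0 < θ n)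
    (hρ : ∀ n, 1 < ρ n) (hθ' : Tendsto θ atTop atTop)
    (hα : Tendsto (fun n => θ n / ρ n) atTop (𝓝 α)) :
    Tendsto (fun n => θ n * Real.log (1 - 1 / ρ n)) atTop (𝓝 (-α)) := by
  have hinv : Tendsto (fun n => 1 / ρ n) atTop (𝓝 0) := by
    refine (hα.div_atTop hθ').congr fun n => ?_
    have := hθ n
    have := hρ n
    field_simp
  have hlow : Tendsto (fun n => -(θ n / ρ n / (1 - 1 / ρ n))) atTop (𝓝 (-α)) := by
    simpa using (hα.div (tendsto_const_nhds.sub hinv) (by norm_num : (1 : ℝ) - 0 ≠ 0)).neg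
  have hpos : ∀ n, 0 < 1 - 1 / ρ n := fun n => by
    rw [sub_pos, div_lt_one (by linarith [hρ n])]
    exact hρ n
  refine tendsto_of_tendsto_of_tendsto_of_le_of_le hlow hα.neg (fun n => ?_) (fun n => ?_)
  · have h := mul_le_mul_of_nonneg_left (Real.one_sub_inv_le_log_of_pos (hpos n)) (hθ n).le
    refine le_of_eq_of_le ?_ h
    have := (hpos n).ne'
    rw [eq_comm, div_div, mul_one_sub, ← sub_eq_zero]
    have h1 := hρ n
    have h2 : ρ n - 1 ≠ 0 := by linarith
    have h3 : 1 - 1 / ρ n = (ρ n - 1) / ρ n := by field_simp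
    rw [h3]
    field_simp
    ring
  · have h := mul_le_mul_of_nonneg_left (Real.log_le_sub_one_of_pos (hpos n)) (hθ n).le
    refine h.trans_eq ?_
    ring

theorem Ewt_exp_eq {k ℓ n : ℕ} (hk : 1 ≤ k) (v : Fin ℓ → Fin k) {x θ : ℝ} (hx : x < 1)
    (hθ : 0 < θ) (t : ℝ) :
    Ewt k ℓ v n x (fun w => Real.exp (t * (occ k ℓ n v w : ℝ) / θ)) =
      (𝔼 w : Fin n → Fin k, Real.exp ((t + θ * Real.log (1 - x)) / θ * occ k ℓ n v w)) /
      𝔼 w : Fin n → Fin k, Real.exp (θ * Real.log (1 - x) / θ * occ k ℓ n v w) := by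
  have : Nonempty (Fin k) := ⟨⟨0, hk⟩⟩
  have hpow : ∀ w : Fin n → Fin k, (1 - x) ^ occ k ℓ n v w
      = Real.exp (θ * Real.log (1 - x) / θ * occ k ℓ n v w) := fun w => by
    rw [mul_div_cancel_left₀ _ hθ.ne', mul_comm, Real.exp_nat_mul,
      Real.exp_log (by linarith)]
  unfold Ewt cfun
  rw [Fintype.expect_eq_sum_div_card, Fintype.expect_eq_sum_div_card,
    div_div_div_cancel_right₀ (by positivity)]
  congr 1
  · refine sum_congr rfl fun w _ => ?_
    rw [hpow, ← Real.exp_add]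
    congr 1
    ring
  · exact sum_congr rfl fun w _ => hpow w

theorem Ewt_exp_pos {k ℓ n : ℕ} (hk : 1 ≤ k) (v : Fin ℓ → Fin k) {x θ : ℝ} (hx : x < 1)
    (hθ : 0 < θ) (t : ℝ) :
    0 < Ewt k ℓ v n x (fun w => Real.exp (t * (occ k ℓ n v w : ℝ) / θ)) := by
  have : Nonempty (Fin k) := ⟨⟨0, hk⟩⟩
  rw [Ewt_exp_eq hk v hx hθ]
  exact div_pos (Finset.expect_pos (fun _ _ => Real.exp_pos _) univ_nonempty)
    (Finset.expect_pos (fun _ _ => Real.exp_pos _) univ_nonempty)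

theorem tendsto_div_muX_mul_log_Ewt {k ℓ : ℕ} (hk : 1 ≤ k) (hl : 1 ≤ ℓ) (v : Fin ℓ → Fin k)
    {θ ρ : ℕ → ℝ} {lam α : ℝ} (hθ : ∀ n, 0 < θ n) (hρ : ∀ n, 1 < ρ n)
    (hθ' : Tendsto θ atTop atTop)
    (hlam : Tendsto (fun n => muX k ℓ v n / θ n) atTop (𝓝 lam))
    (hα : Tendsto (fun n => θ n / ρ n) atTop (𝓝 α)) (t : ℝ) :
    Tendsto (fun n => θ n / muX k ℓ v n * Real.log (Ewt k ℓ v n (1 / ρ n)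
      (fun w => Real.exp (t * (occ k ℓ n v w : ℝ) / θ n)))) atTop (𝓝 t) := by
  have : Nonempty (Fin k) := ⟨⟨0, hk⟩⟩
  have hs := tendsto_mul_log_one_sub_one_div hθ hρ hθ' hα
  have h := (tendsto_div_muX_mul_log_expect hk hl v hθ hlam (hs.const_add t)).sub
    (tendsto_div_muX_mul_log_expect hk hl v hθ hlam hs)
  rw [add_sub_cancel_right] at h
  refine h.congr fun n => ?_
  have hx : 1 / ρ n < 1 := by
    rw [div_lt_one (by linarith [hρ n])]
    exact hρ n
  rw [Ewt_exp_eq hk v hx (hθ n), Real.log_div, mul_sub]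
  · exact (Finset.expect_pos (fun _ _ => Real.exp_pos _) univ_nonempty).ne'
  · exact (Finset.expect_pos (fun _ _ => Real.exp_pos _) univ_nonempty).ne'

end Occurrences

/-- Theorem E(a): under the weakly-avoiding measure `Q^{v,1/ρ_n}_{k,n}`, if `θ_n → ∞`,
`μ_n/θ_n → λ ∈ [0,∞)` and `θ_n/ρ_n → α ∈ [0,∞)`, then
`(θ_n/μ_n)·log E^{v,1/ρ_n}(e^{tX_n/θ_n}) → t`; in particular if `n^ℓ/ρ_n` converges in
`[0,∞)`, then `E^{v,1/ρ_n}(e^{tX_n/n^ℓ}) → exp(t·C(k,d)/(k^ℓ ℓ!))`. -/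
theorem weak_avoidance_mgf_limits (k ℓ : ℕ) (hk : 1 ≤ k) (hl : 2 ≤ ℓ)
    (v : Fin ℓ → Fin k) :
    (∀ (θ ρ : ℕ → ℝ), (∀ n, 0 < θ n) → (∀ n, 1 < ρ n) →
      Tendsto θ atTop atTop →
      ∀ lam : ℝ, 0 ≤ lam → Tendsto (fun n : ℕ => muX k ℓ v n / θ n) atTop (𝓝 lam) →
      ∀ α : ℝ, 0 ≤ α → Tendsto (fun n : ℕ => θ n / ρ n) atTop (𝓝 α) →
      ∀ t : ℝ,
        Tendsto (fun n : ℕ => θ n / muX k ℓ v n *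
            Real.log (Ewt k ℓ v n (1 / ρ n)
              (fun w => Real.exp (t * (occ k ℓ n v w : ℝ) / θ n))))
          atTop (𝓝 t)) ∧
    (∀ ρ : ℕ → ℝ, (∀ n, 1 < ρ n) →
      ∀ γ : ℝ, 0 ≤ γ → Tendsto (fun n : ℕ => (n : ℝ) ^ ℓ / ρ n) atTop (𝓝 γ) →
      ∀ t : ℝ,
        Tendsto (fun n : ℕ => Ewt k ℓ v n (1 / ρ n)
            (fun w => Real.exp (t * (occ k ℓ n v w : ℝ) / (n : ℝ) ^ ℓ)))
          atTop (𝓝 (Real.exp (t * (k.choose (dLetters k ℓ v) : ℝ)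
            / ((k : ℝ) ^ ℓ * (ℓ.factorial : ℝ)))))) := by
  refine ⟨fun θ ρ hθ hρ hθ' lam _ hlam α _ hα t =>
    tendsto_div_muX_mul_log_Ewt hk (by omega) v hθ hρ hθ' hlam hα t, fun ρ hρ γ _ hγ t => ?_⟩
  -- At `n = 0` the scale `n ^ ℓ` vanishes, so it is replaced by `1` there.
  let θ : ℕ → ℝ := fun n => if n = 0 then 1 else (n : ℝ) ^ ℓ
  have hθeq : ∀ᶠ n : ℕ in atTop, θ n = (n : ℝ) ^ ℓ := by
    filter_upwards [eventually_ne_atTop 0] with n hn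
    simp [θ, hn]
  have hθ : ∀ n, 0 < θ n := fun n => by
    rcases Nat.eq_zero_or_pos n with rfl | hn
    · simp [θ]
    · simp only [θ, hn.ne', if_false]
      positivity
  have hθ' : Tendsto θ atTop atTop :=
    ((tendsto_pow_atTop (by omega : ℓ ≠ 0)).comp tendsto_natCast_atTop_atTop).congr'
      (hθeq.mono fun n hn => hn.symm)
  have hlam : Tendsto (fun n => muX k ℓ v n / θ n) atTop
      (𝓝 (matchProb k ℓ v / (ℓ.factorial : ℝ))) :=
    (tendsto_muX_div_pow ℓ hk v).congr' (hθeq.mono fun n hn => by simp only [hn])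
  have hα : Tendsto (fun n => θ n / ρ n) atTop (𝓝 γ) :=
    hγ.congr' (hθeq.mono fun n hn => by simp only [hn])
  have h := ((tendsto_div_muX_mul_log_Ewt hk (by omega) v hθ hρ hθ' hlam hα t).mul hlam).rexp
  have hval : t * (matchProb k ℓ v / (ℓ.factorial : ℝ))
      = t * (k.choose (dLetters k ℓ v) : ℝ) / ((k : ℝ) ^ ℓ * (ℓ.factorial : ℝ)) := by
    rw [matchProb]
    ring
  rw [hval] at h
  refine h.congr' ?_
  filter_upwards [hθeq, eventually_ge_atTop ℓ] with n hn hln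
  have hmu := muX_pos hk v hln
  have hθn := hθ n
  have hx : 1 / ρ n < 1 := by
    rw [div_lt_one (by linarith [hρ n])]
    exact hρ n
  rw [← hn, mul_right_comm, div_mul_div_cancel₀ hmu.ne', div_self hθn.ne', one_mul,
    Real.exp_log (Ewt_exp_pos hk v hx hθn t)]
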